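/- arXiv:2111.13422 — 2 statements merged into one kernel-verified Lean document; each statement's English description precedes it below -/
import Mathlib

section
/- Let R be a commutative ring and let C be an R-algebra that is free of rank 2 as an R-module. Then there exists an element τ ∈ C such that the pair (1, τ) is an R-module basis of C. -/
/-- Let `R` be a commutative ring and `C` an `R`-algebra that is free of
rank 2 as an `R`-module (i.e. it admits a basis indexed by a two-element type). Then there
exists `τ ∈ C` such that `(1, τ)` is an `R`-module basis of `C`. -/
theorem free_quadratic_algebra_has_basis_one_tau
    (R C : Type*) [CommRing R] [Ring C] [Algebra R C]
    (b : Module.Basis (Fin 2) R C) :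
    ∃ τ : C, ∃ b' : Module.Basis (Fin 2) R C, b' 0 = 1 ∧ b' 1 = τ := by
  set p := b.repr 1 0 with hp
  set q := b.repr 1 1 with hq
  have h1 : (1 : C) = p • b 0 + q • b 1 := by
    have h := b.sum_repr 1
    rw [Fin.sum_univ_two] at h
    exact h.symm
  set r := b.repr (b 0 * b 0) 0 with hr
  set s := b.repr (b 1 * b 0) 0 with hs
  have key : p * r + q * s = 1 := by
    have h2 : b 0 = p • (b 0 * b 0) + q • (b 1 * b 0) := by
      rw [← smul_mul_assoc, ← smul_mul_assoc, ← add_mul, ← h1, one_mul]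
    have h3 := congrArg (fun x => b.repr x 0) h2
    simp only [map_add, map_smul, Finsupp.add_apply, Finsupp.smul_apply, smul_eq_mul,
      Module.Basis.repr_self, Finsupp.single_eq_same] at h3
    exact h3.symm
  have hdet : IsUnit (b.det ![1, (-s) • b 0 + r • b 1]) := by
    have : b.det ![1, (-s) • b 0 + r • b 1] = 1 := by
      rw [Module.Basis.det_apply, Matrix.det_fin_two]
      simp [Module.Basis.toMatrix_apply, ← hp, ← hq]
      linear_combination key
    rw [this]
    exact isUnit_one
  obtain ⟨hli, hsp⟩ := (Module.Basis.is_basis_iff_det b).2 hdet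
  refine ⟨_, Module.Basis.mk hli hsp.ge, ?_, rfl⟩
  simp
end

section
/- Let R be an integral domain, let a, b, c ∈ R with a ≠ 0, and let C = R[τ]/(τ² + b·τ + a·c) with τ the class of x. Then the ideal of C generated by τ and the image of a is free of rank 2 as an R-module; specifically, the pair (a·1, τ) is an R-module basis of this ideal. -/
open Polynomial

/-- Let `R` be an integral domain, `a b c ∈ R` with `a ≠ 0`, and
`C = R[τ]/(τ² + b·τ + a·c)`. Then the ideal of `C` generated by `τ` and `a·1` is free of
rank 2 as an `R`-module, with `R`-basis `(a·1, τ)`. -/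
theorem ideal_tau_a_is_free_rank_two
    (R : Type*) [CommRing R] [IsDomain R] (a b c : R) (ha : a ≠ 0) :
    ∃ bas : Module.Basis (Fin 2) R
      (Ideal.span ({AdjoinRoot.root (X ^ 2 + C b * X + C (a * c)),
        algebraMap R (AdjoinRoot (X ^ 2 + C b * X + C (a * c))) a} :
          Set (AdjoinRoot (X ^ 2 + C b * X + C (a * c))))),
      (bas 0 : AdjoinRoot (X ^ 2 + C b * X + C (a * c))) =
          algebraMap R (AdjoinRoot (X ^ 2 + C b * X + C (a * c))) a ∧
      (bas 1 : AdjoinRoot (X ^ 2 + C b * X + C (a * c))) =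
          AdjoinRoot.root (X ^ 2 + C b * X + C (a * c)) := by
  set f : R[X] := X ^ 2 + C b * X + C (a * c) with hf
  have hdeg : f.degree = 2 := by rw [hf]; compute_degree!
  set t := AdjoinRoot.root f with ht
  have hroot : t * t = -(algebraMap R (AdjoinRoot f) b * t) - algebraMap R (AdjoinRoot f) (a * c) := by
    have h : AdjoinRoot.mk f (X ^ 2 + C b * X + C (a * c)) = 0 := AdjoinRoot.mk_self
    simp only [map_add, map_mul, map_pow, AdjoinRoot.mk_X, AdjoinRoot.mk_C] at h
    simp only [AdjoinRoot.algebraMap_eq, map_mul]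
    linear_combination h
  have key : ∀ (p : R[X]) (s u : R), ∃ s' u' : R,
      AdjoinRoot.mk f p * (algebraMap R (AdjoinRoot f) (s * a) + algebraMap R _ u * t) =
        algebraMap R (AdjoinRoot f) (s' * a) + algebraMap R _ u' * t := by
    intro p
    induction p using Polynomial.induction_on' with
    | add p q hp hq =>
      intro s u
      obtain ⟨s1, u1, h1⟩ := hp s u
      obtain ⟨s2, u2, h2⟩ := hq s u
      refine ⟨s1 + s2, u1 + u2, ?_⟩
      rw [map_add, add_mul, h1, h2]
      simp only [map_add, map_mul]
      ring
    | monomial n r =>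
      induction n with
      | zero =>
        intro s u
        refine ⟨r * s, r * u, ?_⟩
        rw [monomial_zero_left, AdjoinRoot.mk_C, ← AdjoinRoot.algebraMap_eq]
        simp only [map_mul]
        ring
      | succ n ih =>
        intro s u
        obtain ⟨s1, u1, h1⟩ := ih (-(u * c)) (s * a - u * b)
        refine ⟨s1, u1, ?_⟩
        rw [← h1, ← monomial_mul_X, map_mul, AdjoinRoot.mk_X, ← ht]
        simp only [map_mul, map_sub, map_neg] at hroot ⊢
        linear_combination (AdjoinRoot.mk f (monomial n r)) * (algebraMap R (AdjoinRoot f) u) * hroot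
  have hta : t ∈ Ideal.span ({t, algebraMap R (AdjoinRoot f) a} : Set (AdjoinRoot f)) :=
    Ideal.subset_span (by simp)
  have haa : algebraMap R (AdjoinRoot f) a ∈
      Ideal.span ({t, algebraMap R (AdjoinRoot f) a} : Set (AdjoinRoot f)) :=
    Ideal.subset_span (by simp)
  let v : Fin 2 → Ideal.span ({t, algebraMap R (AdjoinRoot f) a} : Set (AdjoinRoot f)) :=
    ![⟨_, haa⟩, ⟨_, hta⟩]
  have hli : LinearIndependent R v := by
    rw [LinearIndependent.pair_iff]
    intro s u h
    have h' := congrArg Subtype.val h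
    simp only [Submodule.coe_add, Submodule.coe_smul_of_tower, ZeroMemClass.coe_zero,
      Algebra.smul_def] at h'
    have h2 : AdjoinRoot.mk f (C u * X + C (s * a)) = 0 := by
      simp only [map_add, map_mul, AdjoinRoot.mk_X, AdjoinRoot.mk_C]
      simp only [AdjoinRoot.algebraMap_eq] at h'
      rw [← h', add_comm]
    rw [AdjoinRoot.mk_eq_zero] at h2
    have h3 := eq_zero_of_dvd_of_degree_lt h2
      (by rw [hdeg]; exact lt_of_le_of_lt degree_linear_le (by norm_num))
    have e0 := congrArg (fun p => coeff p 0) h3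
    have e1 := congrArg (fun p => coeff p 1) h3
    simp [coeff_C, ha] at e0 e1
    exact ⟨e0, e1⟩
  have hsp : ⊤ ≤ Submodule.span R (Set.range v) := by
    rintro ⟨z, hz⟩ -
    obtain ⟨p, q, hpq⟩ := Ideal.mem_span_pair.1 hz
    obtain ⟨p, rfl⟩ := AdjoinRoot.mk_surjective p
    obtain ⟨q, rfl⟩ := AdjoinRoot.mk_surjective q
    obtain ⟨s1, u1, h1⟩ := key p 0 1
    obtain ⟨s2, u2, h2⟩ := key q 1 0
    have hz' : (⟨z, hz⟩ : Ideal.span ({t, algebraMap R (AdjoinRoot f) a} : Set (AdjoinRoot f))) =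
        (s1 + s2) • v 0 + (u1 + u2) • v 1 := by
      apply Subtype.ext
      simp only [Submodule.coe_add, Submodule.coe_smul_of_tower, Algebra.smul_def]
      change z = _ * algebraMap R (AdjoinRoot f) a + _ * t
      rw [← hpq]
      simp only [map_add, map_mul, map_zero, map_one] at h1 h2 ⊢
      linear_combination h1 + h2
    rw [hz']
    exact Submodule.add_mem _
      (Submodule.smul_mem _ _ (Submodule.subset_span ⟨0, rfl⟩))
      (Submodule.smul_mem _ _ (Submodule.subset_span ⟨1, rfl⟩))
  refine ⟨Module.Basis.mk hli hsp, ?_, ?_⟩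
  · rw [Module.Basis.mk_apply]; rfl
  · rw [Module.Basis.mk_apply]; rfl
end
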